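/- For all a, b, c ∈ ℝ with a² + b² + c² = 1, the matrix A = a(E₁₂−E₃₄) + b(E₁₃+E₂₄) + c(E₁₄−E₂₃) − E₅₆ (the 2-form a(e¹²−e³⁴) + b(e¹³−e⁴²) + c(e¹⁴−e²³) − e⁵⁶) satisfies A² = −I, lies in the SO(6)-conjugation orbit of J₀ (it is an orthogonal complex structure compatible with the standard orientation), and its moment map image is μ(A) = (a, −a, −1), a point of the edge of the moment tetrahedron joining the vertices (1,−1,−1) and (−1,1,−1). -/

import Mathlib

open Matrix

noncomputable section

/-- The skew-symmetric matrix of the 2-form `eⁱ ∧ eʲ`. -/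
def E (i j : Fin 6) : Matrix (Fin 6) (Fin 6) ℝ := fun k l =>
  (if k = j ∧ l = i then (1 : ℝ) else 0) - (if k = i ∧ l = j then (1 : ℝ) else 0)

/-- The standard orthogonal complex structure `J₀ = E₁₂ + E₃₄ + E₅₆`. -/
def J₀ : Matrix (Fin 6) (Fin 6) ℝ := E 0 1 + E 2 3 + E 4 5

/-- The toric moment map `μ(A) = (⟨Ae₁,e₂⟩, ⟨Ae₃,e₄⟩, ⟨Ae₅,e₆⟩)`. -/
def μ (A : Matrix (Fin 6) (Fin 6) ℝ) : ℝ × ℝ × ℝ := (A 1 0, A 3 2, A 5 4)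

/-- A unit vector `(a, b, c)` is the image of `(1, 0, 0)` under the half-turn about some unit
vector `(s, t, r)`. -/
theorem exists_half_turn (a b c : ℝ) (h : a ^ 2 + b ^ 2 + c ^ 2 = 1) :
    ∃ s t r : ℝ, s ^ 2 + t ^ 2 + r ^ 2 = 1 ∧ a = 2 * s ^ 2 - 1 ∧ b = 2 * s * t ∧
      c = 2 * s * r := by
  have ha : -1 ≤ a := by nlinarith [sq_nonneg b, sq_nonneg c]
  rcases ha.eq_or_lt with rfl | ha
  · have hb : b = 0 := by nlinarith [sq_nonneg b, sq_nonneg c]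
    have hc : c = 0 := by nlinarith [sq_nonneg b, sq_nonneg c]
    exact ⟨0, 1, 0, by norm_num, by norm_num, by simp [hb], by simp [hc]⟩
  · have hpos : 0 < (1 + a) / 2 := by linarith
    obtain ⟨s, hs, hs2⟩ : ∃ s : ℝ, 0 < s ∧ s ^ 2 = (1 + a) / 2 :=
      ⟨√((1 + a) / 2), Real.sqrt_pos.2 hpos, Real.sq_sqrt hpos.le⟩
    refine ⟨s, b / (2 * s), c / (2 * s), ?_, by linarith, by field_simp, by field_simp⟩
    field_simp
    have has : a = 2 * s ^ 2 - 1 := by linarith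
    subst has
    linear_combination h

/-- The rotation that exchanges the third and fourth, and the fifth and sixth, basis vectors and
then applies the quaternion `s i + t j + r k` to the first four coordinates. -/
def quaternionRotation (s t r : ℝ) : Matrix (Fin 6) (Fin 6) ℝ :=
  !![0, -s, -r, -t, 0, 0;
     s, 0, -t, r, 0, 0;
     t, -r, s, 0, 0, 0;
     r, t, 0, -s, 0, 0;
     0, 0, 0, 0, 0, 1;
     0, 0, 0, 0, 1, 0]

theorem quaternionRotation_mul_transpose {s t r : ℝ} (h : s ^ 2 + t ^ 2 + r ^ 2 = 1) :
    quaternionRotation s t r * (quaternionRotation s t r)ᵀ = 1 := by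
  ext i j
  fin_cases i <;> fin_cases j <;>
    simp [quaternionRotation, Matrix.mul_apply, Fin.sum_univ_succ] <;> linarith

theorem det_quaternionRotation {s t r : ℝ} (h : s ^ 2 + t ^ 2 + r ^ 2 = 1) :
    (quaternionRotation s t r).det = 1 := by
  have key : (quaternionRotation s t r).det = (s ^ 2 + t ^ 2 + r ^ 2) ^ 2 := by
    simp [quaternionRotation, Matrix.det_succ_row_zero, Fin.sum_univ_succ, Fin.succAbove]
    ring
  rw [key, h, one_pow]

theorem J₀_eq : J₀ =
    !![0, -1, 0, 0, 0, 0;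
       1, 0, 0, 0, 0, 0;
       0, 0, 0, -1, 0, 0;
       0, 0, 1, 0, 0, 0;
       0, 0, 0, 0, 0, -1;
       0, 0, 0, 0, 1, 0] := by
  ext i j
  fin_cases i <;> fin_cases j <;> simp [J₀, E]

theorem J₀_mul_J₀ : J₀ * J₀ = -1 := by
  rw [J₀_eq]
  ext i j
  fin_cases i <;> fin_cases j <;> simp [Matrix.mul_apply, Fin.sum_univ_succ]

theorem edge_eq (a b c : ℝ) :
    a • (E 0 1 - E 2 3) + b • (E 0 2 + E 1 3) + c • (E 0 3 - E 1 2) - E 4 5 =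
    !![0, -a, -b, -c, 0, 0;
       a, 0, c, -b, 0, 0;
       b, -c, 0, a, 0, 0;
       c, b, -a, 0, 0, 0;
       0, 0, 0, 0, 0, 1;
       0, 0, 0, 0, -1, 0] := by
  ext i j
  fin_cases i <;> fin_cases j <;> simp [E]

theorem quaternionRotation_conj_J₀ {s t r : ℝ} (h : s ^ 2 + t ^ 2 + r ^ 2 = 1) :
    quaternionRotation s t r * J₀ * (quaternionRotation s t r)ᵀ =
      (2 * s ^ 2 - 1) • (E 0 1 - E 2 3) + (2 * s * t) • (E 0 2 + E 1 3) +
        (2 * s * r) • (E 0 3 - E 1 2) - E 4 5 := by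
  rw [edge_eq, J₀_eq]
  ext i j
  fin_cases i <;> fin_cases j <;>
    simp [quaternionRotation, Matrix.mul_apply, Fin.sum_univ_succ] <;> linarith

/-- For `a² + b² + c² = 1`, the 2-form
`a(e¹²−e³⁴) + b(e¹³+e²⁴) + c(e¹⁴−e²³) − e⁵⁶` is an orthogonal complex structure
compatible with the standard orientation, and it projects to the point
`(a, −a, −1)` of the edge of the moment tetrahedron joining `(1,−1,−1)` and
`(−1,1,−1)`. -/
theorem edge_of_tetrahedron (a b c : ℝ) (h : a ^ 2 + b ^ 2 + c ^ 2 = 1) :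
    (a • (E 0 1 - E 2 3) + b • (E 0 2 + E 1 3) + c • (E 0 3 - E 1 2) - E 4 5) *
        (a • (E 0 1 - E 2 3) + b • (E 0 2 + E 1 3) + c • (E 0 3 - E 1 2) - E 4 5) = -1 ∧
    (∃ P : Matrix (Fin 6) (Fin 6) ℝ, P * Pᵀ = 1 ∧ P.det = 1 ∧
        a • (E 0 1 - E 2 3) + b • (E 0 2 + E 1 3) + c • (E 0 3 - E 1 2) - E 4 5 =
          P * J₀ * Pᵀ) ∧
    μ (a • (E 0 1 - E 2 3) + b • (E 0 2 + E 1 3) + c • (E 0 3 - E 1 2) - E 4 5) =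
      (a, -a, -1) := by
  obtain ⟨s, t, r, hu, rfl, rfl, rfl⟩ := exists_half_turn a b c h
  have hP := quaternionRotation_mul_transpose hu
  have hP' := mul_eq_one_comm.1 hP
  rw [← quaternionRotation_conj_J₀ hu]
  set P := quaternionRotation s t r with hPdef
  refine ⟨?_, ⟨P, hP, det_quaternionRotation hu, rfl⟩, ?_⟩
  · calc P * J₀ * Pᵀ * (P * J₀ * Pᵀ) = P * J₀ * (Pᵀ * P) * J₀ * Pᵀ := by noncomm_ring
      _ = P * (J₀ * J₀) * Pᵀ := by rw [hP']; noncomm_ring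
      _ = -1 := by simp [J₀_mul_J₀, hP]
  · rw [hPdef, quaternionRotation_conj_J₀ hu, edge_eq]
    simp [μ]
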